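/- For every positive integer d, the monomial ∏_{1 ≤ j < i ≤ n} Z_{i,j}^d appears with nonzero coefficient in the polynomial (𝔣_n · 𝔤_{n−1})^d. -/

import Mathlib

open MvPolynomial

/-- Evaluation of a multivariate polynomial at `X j = 0` (all other variables kept). -/
noncomputable def setZero {σ : Type*} [DecidableEq σ] {k : Type*} [Field k] (j : σ) :
    MvPolynomial σ k →ₐ[k] MvPolynomial σ k :=
  aeval (fun i => if i = j then 0 else X i)

/-- `IsRNC g J` : `g` is a residual normal crossing relative to the totally ordered
subset of variables given by the (nodup) list `J`, listed in increasing order. -/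
def IsRNC {σ : Type*} [DecidableEq σ] {k : Type*} [Field k] :
    MvPolynomial σ k → List σ → Prop
  | g, [] => ∃ c : k, c ≠ 0 ∧ g = C c
  | g, j :: J => ∃ h : MvPolynomial σ k, g = X j * h ∧ IsRNC (setZero j h) J

/-- The `(i,j)` entry (1-based indices) of the generic lower unitriangular matrix `Z`,
as a polynomial in the variables `Z_{i,j}`, `j < i` (indexed by the pair `(i,j)`). -/
noncomputable def Zent (k : Type*) [Field k] (i j : ℕ) : MvPolynomial (ℕ × ℕ) k :=
  if i = j then 1 else if j < i then X (i, j) else 0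

/-- The minor `v_a` of the generic lower unitriangular matrix with rows the (1-based)
sequence `a` and columns `1, …, s`. -/
noncomputable def vminor (k : Type*) [Field k] {s : ℕ} (a : Fin s → ℕ) :
    MvPolynomial (ℕ × ℕ) k :=
  (Matrix.of fun p q : Fin s => Zent k (a p) ((q : ℕ) + 1)).det

/-- The polynomial `𝔣_r = ∏_{s=1}^{r} v_{(⌊s/2⌋+1, …, s)}`. -/
noncomputable def fRNC (k : Type*) [Field k] (r : ℕ) : MvPolynomial (ℕ × ℕ) k :=
  ∏ s ∈ Finset.Icc 1 r, vminor k (fun p : Fin (s - s / 2) => s / 2 + 1 + (p : ℕ))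

/-- The polynomial `𝔤_r = σ(𝔣_r)`, where `σ` is the variable substitution
`Z_{i,j} ↦ Z_{n+1-j, n+1-i}`. -/
noncomputable def gRNC (k : Type*) [Field k] (n r : ℕ) : MvPolynomial (ℕ × ℕ) k :=
  rename (fun p : ℕ × ℕ => (n + 1 - p.2, n + 1 - p.1)) (fRNC k r)

/-- The (strict part of the) order on the variables `Z_{i,j}` :
`Z_{i,j} < Z_{i',j'}` iff `i+j < i'+j'`, or `i+j = i'+j'` and `i < i'`. -/
def zord : ℕ × ℕ → ℕ × ℕ → Prop :=
  fun p q => p.1 + p.2 < q.1 + q.2 ∨ (p.1 + p.2 = q.1 + q.2 ∧ p.1 < q.1)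

/-- `m` is an exponent of `f`, and every other exponent of `f` has strictly smaller `w`-weight. -/
def IsTopExponent {σ k : Type*} [Field k] (w : σ → ℤ) (f : MvPolynomial σ k) (m : σ →₀ ℕ) :
    Prop :=
  coeff m f ≠ 0 ∧ ∀ m', coeff m' f ≠ 0 → m' = m ∨ Finsupp.weight w m' < Finsupp.weight w m

namespace IsTopExponent

variable {σ k : Type*} [Field k] {w : σ → ℤ}

theorem one : IsTopExponent w (1 : MvPolynomial σ k) 0 := by
  classical
  refine ⟨by simp, fun m' h => Or.inl ?_⟩
  by_contra hne
  exact h (by rw [coeff_one, if_neg (Ne.symm hne)])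

theorem mul {f g : MvPolynomial σ k} {a b : σ →₀ ℕ} (hf : IsTopExponent w f a)
    (hg : IsTopExponent w g b) : IsTopExponent w (f * g) (a + b) := by
  classical
  have key : ∀ x y, coeff x f * coeff y g ≠ 0 →
      (x = a ∧ y = b) ∨ Finsupp.weight w (x + y) < Finsupp.weight w (a + b) := by
    intro x y h
    rw [map_add, map_add]
    rcases hf.2 x (left_ne_zero_of_mul h) with rfl | hx <;>
      rcases hg.2 y (right_ne_zero_of_mul h) with rfl | hy
    · exact Or.inl ⟨rfl, rfl⟩
    all_goals right; linarith
  constructor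
  · rw [coeff_mul, Finset.sum_eq_single (a, b)]
    · exact mul_ne_zero hf.1 hg.1
    · rintro ⟨x, y⟩ hxy hne
      by_contra h
      rcases key x y h with ⟨rfl, rfl⟩ | hlt
      · exact hne rfl
      · rw [Finset.HasAntidiagonal.mem_antidiagonal.mp hxy] at hlt
        exact lt_irrefl _ hlt
    · intro h
      rw [Finset.HasAntidiagonal.mem_antidiagonal] at h
      exact absurd rfl h
  · intro m' h
    rw [coeff_mul] at h
    obtain ⟨⟨x, y⟩, hxy, hne⟩ := Finset.exists_ne_zero_of_sum_ne_zero h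
    rw [← Finset.HasAntidiagonal.mem_antidiagonal.mp hxy]
    rcases key x y hne with ⟨rfl, rfl⟩ | hlt
    · exact Or.inl rfl
    · exact Or.inr hlt

theorem pow {f : MvPolynomial σ k} {a : σ →₀ ℕ} (hf : IsTopExponent w f a) (d : ℕ) :
    IsTopExponent w (f ^ d) (d • a) := by
  induction d with
  | zero => simpa using one
  | succ d ih => rw [pow_succ, succ_nsmul]; exact ih.mul hf

theorem prod {ι : Type*} (S : Finset ι) {f : ι → MvPolynomial σ k} {a : ι → σ →₀ ℕ}
    (h : ∀ i ∈ S, IsTopExponent w (f i) (a i)) :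
    IsTopExponent w (∏ i ∈ S, f i) (∑ i ∈ S, a i) := by
  classical
  induction S using Finset.induction_on with
  | empty => simpa using one
  | insert i S hi ih =>
    rw [Finset.prod_insert hi, Finset.sum_insert hi]
    exact (h i (Finset.mem_insert_self _ _)).mul
      (ih fun j hj => h j (Finset.mem_insert_of_mem hj))

/-- A signed sum of monomials and zeros whose top term is present exactly once. -/
theorem sum_monomial {ι : Type*} [Fintype ι] {f : ι → MvPolynomial σ k} {e : ι → σ →₀ ℕ}
    {c : ι → k} (i₀ : ι) (h₀ : f i₀ = monomial (e i₀) (c i₀)) (hc : c i₀ ≠ 0)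
    (h : ∀ i, i ≠ i₀ → f i = 0 ∨
      (f i = monomial (e i) (c i) ∧ Finsupp.weight w (e i) < Finsupp.weight w (e i₀))) :
    IsTopExponent w (∑ i, f i) (e i₀) := by
  classical
  constructor
  · rw [coeff_sum, Finset.sum_eq_single i₀]
    · rwa [h₀, coeff_monomial, if_pos rfl]
    · intro i _ hi
      rcases h i hi with h | ⟨h, hlt⟩
      · rw [h, coeff_zero]
      · rw [h, coeff_monomial, if_neg]
        intro heq
        rw [heq] at hlt
        exact lt_irrefl _ hlt
    · intro h
      exact absurd (Finset.mem_univ _) h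
  · intro m' hm
    rw [coeff_sum] at hm
    obtain ⟨i, -, hi⟩ := Finset.exists_ne_zero_of_sum_ne_zero hm
    by_cases hii : i = i₀
    · subst hii
      rw [h₀, coeff_monomial] at hi
      exact Or.inl (by_contra fun hne => hi (if_neg (Ne.symm hne)))
    · rcases h i hii with h | ⟨h, hlt⟩
      · exact absurd (by rw [h, coeff_zero]) hi
      · rw [h, coeff_monomial] at hi
        have : e i = m' := by_contra fun hne => hi (if_neg hne)
        exact Or.inr (this ▸ hlt)

end IsTopExponent

/-- The exponent of the `(i, j)` entry of `Z` after renaming the variables along `τ`. -/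
noncomputable def entryExponent (τ : ℕ × ℕ → ℕ × ℕ) (i j : ℕ) : ℕ × ℕ →₀ ℕ :=
  if j < i then Finsupp.single (τ (i, j)) 1 else 0

theorem rename_Zent (k : Type*) [Field k] (τ : ℕ × ℕ → ℕ × ℕ) {i j : ℕ} (h : j ≤ i) :
    rename τ (Zent k i j) = monomial (entryExponent τ i j) 1 := by
  unfold Zent entryExponent
  rcases h.eq_or_lt with rfl | h
  · simp
  · rw [if_neg h.ne', if_pos h, if_pos h, rename_X]; rfl

theorem rename_Zent_of_lt (k : Type*) [Field k] (τ : ℕ × ℕ → ℕ × ℕ) {i j : ℕ} (h : i < j) :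
    rename τ (Zent k i j) = 0 := by
  simp [Zent, h.ne, h.not_gt]

/-- Among all permutations, the reversal uniquely maximizes `∑ (c + π p - p) ^ 2`. -/
theorem sum_sq_lt_sum_sq_rev {m : ℕ} (c : ℤ) (π : Equiv.Perm (Fin m)) (h : π ≠ Fin.revPerm) :
    ∑ p, (c + (π p : ℕ) - (p : ℕ)) ^ 2 <
      ∑ p : Fin m, (c + ((Fin.revPerm p : Fin m) : ℕ) - (p : ℕ)) ^ 2 := by
  have key : ∀ ρ : Equiv.Perm (Fin m),
      ∑ p, (c + (ρ p : ℕ) - (p : ℕ)) ^ 2 + ∑ p, (((ρ p : ℕ) : ℤ) + (p : ℕ) - (m - 1)) ^ 2 =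
        ∑ p : Fin m, (4 * (p : ℤ) ^ 2 - 4 * (m - 1) * (p : ℤ) + c ^ 2 + (m - 1) ^ 2) := by
    intro ρ
    have h1 := Equiv.sum_comp ρ fun p : Fin m => 2 * (p : ℤ) ^ 2 + 2 * (c - (m - 1)) * (p : ℤ)
    have h2 : ∑ p : Fin m, (4 * (p : ℤ) ^ 2 - 4 * (m - 1) * (p : ℤ) + c ^ 2 + (m - 1) ^ 2) =
        ∑ p : Fin m, (2 * (p : ℤ) ^ 2 + 2 * (c - (m - 1)) * (p : ℤ)) +
        ∑ p : Fin m, (2 * (p : ℤ) ^ 2 - 2 * (c + (m - 1)) * (p : ℤ) + c ^ 2 + (m - 1) ^ 2) := by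
      rw [← Finset.sum_add_distrib]
      exact Finset.sum_congr rfl fun p _ => by ring
    rw [h2, ← h1, ← Finset.sum_add_distrib, ← Finset.sum_add_distrib]
    exact Finset.sum_congr rfl fun p _ => by ring
  have hrev : ∑ p : Fin m, (((Fin.revPerm p : Fin m) : ℕ) + ((p : ℕ) : ℤ) - (m - 1)) ^ 2 = 0 := by
    refine Finset.sum_eq_zero fun p _ => ?_
    have : (((Fin.revPerm p : Fin m) : ℕ) : ℤ) = m - 1 - (p : ℕ) := by
      rw [Fin.revPerm_apply, Fin.val_rev]; omega
    rw [this]; ring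
  have hpos : 0 < ∑ p, (((π p : ℕ) : ℤ) + (p : ℕ) - (m - 1)) ^ 2 := by
    obtain ⟨q, hq⟩ : ∃ q, π q ≠ Fin.revPerm q := by
      by_contra! hall
      exact h (Equiv.ext hall)
    refine Finset.sum_pos' (fun p _ => sq_nonneg _) ⟨q, Finset.mem_univ _, ?_⟩
    refine sq_pos_of_ne_zero fun h0 => hq (Fin.ext ?_)
    rw [Fin.revPerm_apply, Fin.val_rev]; omega
  have := key π
  have := key Fin.revPerm
  linarith

/-- The exponent of the antidiagonal term of the `s`-th minor. -/
noncomputable def antidiagExponent (τ : ℕ × ℕ → ℕ × ℕ) (s : ℕ) : ℕ × ℕ →₀ ℕ :=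
  ∑ p ∈ Finset.range (s - s / 2), entryExponent τ (s - p) (p + 1)

theorem isTopExponent_rename_vminor (k : Type*) [Field k] (τ : ℕ × ℕ → ℕ × ℕ) (w : ℕ × ℕ → ℤ)
    (s : ℕ) (hw : ∀ i j, 1 ≤ j → j < i → i ≤ s → w (τ (i, j)) = ((i : ℤ) - j) ^ 2) :
    IsTopExponent w
      (rename τ (vminor k fun p : Fin (s - s / 2) => s / 2 + 1 + (p : ℕ)))
      (antidiagExponent τ s) := by
  have hwe : ∀ i j, 1 ≤ j → j ≤ i → i ≤ s →
      Finsupp.weight w (entryExponent τ i j) = ((i : ℤ) - j) ^ 2 := by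
    intro i j h1 h2 h3
    unfold entryExponent
    rcases h2.eq_or_lt with rfl | h2
    · simp
    · rw [if_pos h2, Finsupp.weight_single, hw i j h1 h2 h3, one_smul]
  set e : Equiv.Perm (Fin (s - s / 2)) → (ℕ × ℕ →₀ ℕ) := fun π =>
    ∑ p, entryExponent τ (s / 2 + 1 + (π p : ℕ)) ((p : ℕ) + 1) with he
  have hexp : antidiagExponent τ s = e Fin.revPerm := by
    rw [antidiagExponent, Finset.sum_range]
    refine Finset.sum_congr rfl fun p _ => ?_
    congr 1
    rw [Fin.revPerm_apply, Fin.val_rev]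
    omega
  have hterm : ∀ π : Equiv.Perm (Fin (s - s / 2)),
      (∀ p : Fin (s - s / 2), (p : ℕ) + 1 ≤ s / 2 + 1 + (π p : ℕ)) →
      rename τ (Equiv.Perm.sign π • ∏ p, Zent k (s / 2 + 1 + (π p : ℕ)) ((p : ℕ) + 1)) =
        monomial (e π) (((Equiv.Perm.sign π : ℤˣ) : ℤ) : k) ∧
      Finsupp.weight w (e π) = ∑ p, (((s / 2 : ℕ) : ℤ) + (π p : ℕ) - (p : ℕ)) ^ 2 := by
    intro π hle
    constructor
    · rw [Units.smul_def, zsmul_eq_mul, map_mul, map_prod, map_intCast,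
        Finset.prod_congr rfl fun p _ => rename_Zent k τ (hle p), ← monomial_sum_one,
        ← map_intCast (C : k →+* MvPolynomial (ℕ × ℕ) k), C_mul_monomial, mul_one]
    · rw [he, map_sum]
      refine Finset.sum_congr rfl fun p _ => ?_
      rw [hwe _ _ (by omega) (hle p) (by have := (π p).isLt; omega)]
      push_cast
      ring
  have hrev : ∀ p : Fin (s - s / 2),
      (p : ℕ) + 1 ≤ s / 2 + 1 + ((Fin.revPerm p : Fin (s - s / 2)) : ℕ) := by
    intro p
    rw [Fin.revPerm_apply, Fin.val_rev]
    have := p.isLt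
    omega
  rw [hexp, vminor, Matrix.det_apply, map_sum]
  simp only [Matrix.of_apply]
  refine IsTopExponent.sum_monomial (c := fun π => (((Equiv.Perm.sign π : ℤˣ) : ℤ) : k))
    Fin.revPerm (hterm _ hrev).1 ?_ fun π hπ => ?_
  · rcases Int.units_eq_one_or (Equiv.Perm.sign (Fin.revPerm : Equiv.Perm (Fin (s - s / 2))))
      with h | h <;> simp [h]
  · by_cases hle : ∀ p : Fin (s - s / 2), (p : ℕ) + 1 ≤ s / 2 + 1 + (π p : ℕ)
    · refine Or.inr ⟨(hterm π hle).1, ?_⟩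
      rw [(hterm π hle).2, (hterm _ hrev).2]
      exact sum_sq_lt_sum_sq_rev _ π hπ
    · push Not at hle
      obtain ⟨p, hp⟩ := hle
      left
      rw [Units.smul_def, zsmul_eq_mul, map_mul, map_prod,
        Finset.prod_eq_zero (Finset.mem_univ p) (rename_Zent_of_lt k τ hp), mul_zero]

theorem isTopExponent_rename_fRNC (k : Type*) [Field k] (τ : ℕ × ℕ → ℕ × ℕ) (w : ℕ × ℕ → ℤ)
    (r : ℕ) (hw : ∀ i j, 1 ≤ j → j < i → i ≤ r → w (τ (i, j)) = ((i : ℤ) - j) ^ 2) :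
    IsTopExponent w (rename τ (fRNC k r)) (∑ s ∈ Finset.Icc 1 r, antidiagExponent τ s) := by
  rw [fRNC, map_prod]
  refine IsTopExponent.prod _ fun s hs => isTopExponent_rename_vminor k τ w s ?_
  exact fun i j h1 h2 h3 => hw i j h1 h2 (h3.trans (Finset.mem_Icc.mp hs).2)

theorem sum_antidiagExponent_eq (τ : ℕ × ℕ → ℕ × ℕ) (r : ℕ) (T : Finset (ℕ × ℕ))
    (ν : ℕ × ℕ → ℕ × ℕ)
    (hτ : ∀ i j, 1 ≤ j → j < i → i + j ≤ r + 1 → τ (i, j) ∈ T ∧ ν (τ (i, j)) = (i, j))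
    (hν : ∀ x ∈ T, 1 ≤ (ν x).2 ∧ (ν x).2 < (ν x).1 ∧ (ν x).1 + (ν x).2 ≤ r + 1 ∧
      τ (ν x) = x) :
    ∑ s ∈ Finset.Icc 1 r, antidiagExponent τ s = ∑ x ∈ T, Finsupp.single x 1 := by
  simp only [antidiagExponent, entryExponent]
  rw [Finset.sum_sigma', ← Finset.sum_filter]
  refine Finset.sum_bij' (fun y _ => τ (y.1 - y.2, y.2 + 1))
    (fun x _ => ⟨(ν x).1 + (ν x).2 - 1, (ν x).2 - 1⟩) ?_ ?_ ?_ ?_ ?_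
  · rintro ⟨s, p⟩ h
    simp only [Finset.mem_filter, Finset.mem_sigma, Finset.mem_Icc, Finset.mem_range] at h
    exact (hτ _ _ (by omega) h.2 (by omega)).1
  · intro x hx
    have := hν x hx
    simp only [Finset.mem_filter, Finset.mem_sigma, Finset.mem_Icc, Finset.mem_range]
    omega
  · rintro ⟨s, p⟩ h
    simp only [Finset.mem_filter, Finset.mem_sigma, Finset.mem_Icc, Finset.mem_range] at h
    simp only [(hτ (s - p) (p + 1) (by omega) h.2 (by omega)).2, Sigma.mk.injEq, heq_eq_eq]
    omega
  · intro x hx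
    obtain ⟨h1, h2, h3, h4⟩ := hν x hx
    conv_rhs => rw [← h4]
    congr 1
    ext <;> dsimp only <;> omega
  · exact fun _ _ => rfl

theorem stmt7 (k : Type*) [Field k] (n : ℕ) (hn : 2 ≤ n) (d : ℕ) (hd : 0 < d) :
    MvPolynomial.coeff
      (∑ p ∈ (Finset.range (n + 1) ×ˢ Finset.range (n + 1)).filter
          (fun p => 1 ≤ p.2 ∧ p.2 < p.1 ∧ p.1 ≤ n), Finsupp.single p d)
      ((fRNC k n * gRNC k n (n - 1)) ^ d) ≠ 0 := by
  set T := (Finset.range (n + 1) ×ˢ Finset.range (n + 1)).filter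
    (fun p => 1 ≤ p.2 ∧ p.2 < p.1 ∧ p.1 ≤ n) with hT
  have hmem : ∀ x, x ∈ T ↔ 1 ≤ x.2 ∧ x.2 < x.1 ∧ x.1 ≤ n := by
    intro x
    simp only [hT, Finset.mem_filter, Finset.mem_product, Finset.mem_range]
    omega
  let w : ℕ × ℕ → ℤ := fun x => ((x.1 : ℤ) - x.2) ^ 2
  let τ : ℕ × ℕ → ℕ × ℕ := fun p => (n + 1 - p.2, n + 1 - p.1)
  have hf := isTopExponent_rename_fRNC k id w n fun _ _ _ _ _ => rfl
  have hg := isTopExponent_rename_fRNC k τ w (n - 1) fun i j h1 h2 h3 => by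
    simp only [w, τ]
    rw [Nat.cast_sub (by omega), Nat.cast_sub (by omega)]
    ring
  have hfe := sum_antidiagExponent_eq id n (T.filter fun x => x.1 + x.2 ≤ n + 1) id
    (fun i j h1 h2 h3 => by simp only [Finset.mem_filter, hmem, id, and_true]; omega)
    (fun x hx => by simp only [Finset.mem_filter, hmem] at hx; simp only [id, and_true]; omega)
  have hge := sum_antidiagExponent_eq τ (n - 1) (T.filter fun x => ¬ x.1 + x.2 ≤ n + 1) τ
    (fun i j h1 h2 h3 => by
      simp only [Finset.mem_filter, hmem, τ, Prod.mk.injEq]; omega)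
    (fun x hx => by
      simp only [Finset.mem_filter, hmem] at hx; simp only [τ, Prod.ext_iff]; omega)
  rw [rename_id_apply] at hf
  have h := ((hf.mul hg).pow d).1
  rw [hfe, hge, Finset.sum_filter_add_sum_filter_not, Finset.smul_sum] at h
  simpa only [Finsupp.smul_single, smul_eq_mul, mul_one, gRNC] using h
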